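/- arXiv:1102.2315 — 2 statements merged into one kernel-verified Lean document; each statement's English description precedes it below -/
import Mathlib

section
/- Let a, b, μ be integers with 0 ≤ a ≤ b and b > 0. Then the naive discrete line D(a, b, μ, b) is 8-connected: for any two points P and Q of D(a, b, μ, b) there is a finite sequence of points of D(a, b, μ, b) starting at P and ending at Q in which any two consecutive points (x, y), (x', y') satisfy max(|x − x'|, |y − y'|) = 1. -/
/-- The discrete line D(a, b, μ, ω): integer points (x, y) with μ ≤ a·x − b·y < μ + ω. -/
def discreteLine (a b μ ω : ℤ) : Set (ℤ × ℤ) :=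
  {p : ℤ × ℤ | μ ≤ a * p.1 - b * p.2 ∧ a * p.1 - b * p.2 < μ + ω}

theorem naive_aux_mem (a b μ : ℤ) (hb : 0 < b) (x : ℤ) :
    (x, (a * x - μ) / b) ∈ discreteLine a b μ b := by
  have h1 := Int.emod_add_mul_ediv (a * x - μ) b
  have h2 := Int.emod_nonneg (a * x - μ) hb.ne'
  have h3 := Int.emod_lt_of_pos (a * x - μ) hb
  simp only [discreteLine, Set.mem_setOf_eq]
  constructor <;> linarith

theorem naive_aux_eq (a b μ : ℤ) (hb : 0 < b) (P : ℤ × ℤ)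
    (hP : P ∈ discreteLine a b μ b) : (P.1, (a * P.1 - μ) / b) = P := by
  obtain ⟨x, y⟩ := P
  simp only [discreteLine, Set.mem_setOf_eq] at hP
  have h : (a * x - μ) / b = y := by
    apply le_antisymm
    · apply Int.le_of_lt_add_one
      rw [Int.ediv_lt_iff_lt_mul hb]
      linarith
    · rw [Int.le_ediv_iff_mul_le hb]
      linarith
  simp [h]

theorem naive_aux_step (a b μ : ℤ) (ha : 0 ≤ a) (hab : a ≤ b) (hb : 0 < b) (x : ℤ) :
    |(a * (x + 1) - μ) / b - (a * x - μ) / b| ≤ 1 := by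
  have h1 : (a * x - μ) / b ≤ (a * (x + 1) - μ) / b :=
    Int.ediv_le_ediv hb (by linarith)
  have h2 : (a * (x + 1) - μ) / b ≤ (a * x - μ + b) / b :=
    Int.ediv_le_ediv hb (by linarith)
  have h3 : (a * x - μ + b) / b = (a * x - μ) / b + 1 := by
    rw [Int.add_ediv_of_dvd_right (dvd_refl b), Int.ediv_self hb.ne']
  rw [abs_le]
  constructor <;> linarith

theorem naive_line_eight_connected (a b μ : ℤ) (ha : 0 ≤ a) (hab : a ≤ b) (hb : 0 < b) :
    ∀ P Q : ℤ × ℤ, P ∈ discreteLine a b μ b → Q ∈ discreteLine a b μ b →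
      ∃ (n : ℕ) (f : ℕ → ℤ × ℤ), f 0 = P ∧ f n = Q ∧
        (∀ i ≤ n, f i ∈ discreteLine a b μ b) ∧
        (∀ i < n, max |(f (i + 1)).1 - (f i).1| |(f (i + 1)).2 - (f i).2| = 1) := by
  intro P Q hP hQ
  rcases le_total P.1 Q.1 with h | h
  · refine ⟨(Q.1 - P.1).toNat, fun i => (P.1 + i, (a * (P.1 + i) - μ) / b), ?_, ?_, ?_, ?_⟩
    · simpa using naive_aux_eq a b μ hb P hP
    · have e : P.1 + ((Q.1 - P.1).toNat : ℤ) = Q.1 := by omega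
      simp only [e]
      exact naive_aux_eq a b μ hb Q hQ
    · intro i _
      exact naive_aux_mem a b μ hb _
    · intro i _
      have s := naive_aux_step a b μ ha hab hb (P.1 + i)
      have e : P.1 + ((i + 1 : ℕ) : ℤ) = P.1 + i + 1 := by push_cast; ring
      have e2 : |P.1 + (i : ℤ) + 1 - (P.1 + i)| = 1 := by simp
      simp only [e, e2]
      exact max_eq_left s
  · refine ⟨(P.1 - Q.1).toNat, fun i => (P.1 - i, (a * (P.1 - i) - μ) / b), ?_, ?_, ?_, ?_⟩
    · simpa using naive_aux_eq a b μ hb P hP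
    · have e : P.1 - ((P.1 - Q.1).toNat : ℤ) = Q.1 := by omega
      simp only [e]
      exact naive_aux_eq a b μ hb Q hQ
    · intro i _
      exact naive_aux_mem a b μ hb _
    · intro i _
      have s := naive_aux_step a b μ ha hab hb (P.1 - ((i + 1 : ℕ) : ℤ))
      have e : P.1 - ((i + 1 : ℕ) : ℤ) + 1 = P.1 - i := by push_cast; ring
      have e2 : |P.1 - ((i + 1 : ℕ) : ℤ) - (P.1 - i)| = 1 := by
        rw [← e]; simp
      rw [e, abs_sub_comm] at s
      simp only [e2]
      exact max_eq_left s
end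

section
/- Let a, b, μ be integers with 0 ≤ a ≤ b and b > 0. Then the standard discrete line D(a, b, μ, a + b) is 4-connected: for any two points P and Q of D(a, b, μ, a + b) there is a finite sequence of points of D(a, b, μ, a + b) starting at P and ending at Q in which any two consecutive points (x, y), (x', y') satisfy |x − x'| + |y − y'| = 1. -/
/-- Two points of the line on the same antidiagonal coincide; otherwise walk greedily
towards larger `x + y`. -/
theorem forward_path (a b μ : ℤ) (ha : 0 ≤ a) (hb : 0 < b) (n : ℕ) :
    ∀ P Q : ℤ × ℤ, P ∈ discreteLine a b μ (a + b) → Q ∈ discreteLine a b μ (a + b) →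
      Q.1 + Q.2 = P.1 + P.2 + n →
      ∃ (f : ℕ → ℤ × ℤ), f 0 = P ∧ f n = Q ∧
        (∀ i ≤ n, f i ∈ discreteLine a b μ (a + b)) ∧
        (∀ i < n, |(f (i + 1)).1 - (f i).1| + |(f (i + 1)).2 - (f i).2| = 1) := by
  induction n with
  | zero =>
    rintro ⟨x, y⟩ ⟨x', y'⟩ hP hQ h
    have hP' := hP
    simp only [discreteLine, Set.mem_ofPred_eq] at hP' hQ
    simp only [Nat.cast_zero, add_zero] at h
    obtain rfl : y' = x + y - x' := by omega
    have h1 : (a + b) * (x' - x) < (a + b) * 1 := by linarith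
    have h2 : (a + b) * (-1) < (a + b) * (x' - x) := by linarith
    have h3 := lt_of_mul_lt_mul_left h1 (by omega)
    have h4 := lt_of_mul_lt_mul_left h2 (by omega)
    obtain rfl : x' = x := by omega
    exact ⟨fun _ => (x', y), rfl, by simp, fun _ _ => hP, by simp⟩
  | succ n ih =>
    rintro ⟨x, y⟩ Q hP hQ h
    obtain ⟨R, hR, hs, hd⟩ : ∃ R : ℤ × ℤ, R ∈ discreteLine a b μ (a + b) ∧
        R.1 + R.2 = x + y + 1 ∧ |R.1 - x| + |R.2 - y| = 1 := by
      have hP' := hP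
      simp only [discreteLine, Set.mem_ofPred_eq] at hP'
      by_cases hc : a * x - b * y < μ + b
      · refine ⟨(x + 1, y), ?_, by ring, by simp⟩
        simp only [discreteLine, Set.mem_ofPred_eq]
        constructor <;> linarith
      · refine ⟨(x, y + 1), ?_, by ring, by simp⟩
        simp only [discreteLine, Set.mem_ofPred_eq]
        constructor <;> linarith
    obtain ⟨g, g0, gn, gm, gd⟩ := ih R Q hR hQ (by push_cast at h; omega)
    refine ⟨fun i => Nat.casesOn i (x, y) g, rfl, gn, ?_, ?_⟩
    · rintro (_ | i) hi
      · exact hP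
      · exact gm i (by omega)
    · rintro (_ | i) hi
      · simpa [g0] using hd
      · exact gd i (by omega)

theorem standard_line_four_connected (a b μ : ℤ) (ha : 0 ≤ a) (hab : a ≤ b) (hb : 0 < b) :
    ∀ P Q : ℤ × ℤ, P ∈ discreteLine a b μ (a + b) → Q ∈ discreteLine a b μ (a + b) →
      ∃ (n : ℕ) (f : ℕ → ℤ × ℤ), f 0 = P ∧ f n = Q ∧
        (∀ i ≤ n, f i ∈ discreteLine a b μ (a + b)) ∧
        (∀ i < n, |(f (i + 1)).1 - (f i).1| + |(f (i + 1)).2 - (f i).2| = 1) := by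
  intro P Q hP hQ
  rcases le_total (P.1 + P.2) (Q.1 + Q.2) with h | h
  · exact ⟨(Q.1 + Q.2 - (P.1 + P.2)).toNat,
      forward_path a b μ ha hb _ P Q hP hQ (by omega)⟩
  · obtain ⟨f, f0, fn, fm, fd⟩ := forward_path a b μ ha hb
      (P.1 + P.2 - (Q.1 + Q.2)).toNat Q P hQ hP (by omega)
    generalize (P.1 + P.2 - (Q.1 + Q.2)).toNat = n at *
    refine ⟨n, fun i => f (n - i), by simpa using fn, by simpa using f0,
      fun i _ => fm _ (by omega), fun i hi => ?_⟩
    have := fd (n - (i + 1)) (by omega)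
    rw [show n - (i + 1) + 1 = n - i by omega] at this
    simp only
    rw [abs_sub_comm, abs_sub_comm (f (n - (i + 1))).2]
    exact this
end
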